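/- arXiv:1705.07597 — 2 statements merged into one kernel-verified Lean document; each statement's English description precedes it below -/
import Mathlib

section
/- Let d ≥ 2 and let A, B, C, D be d×d complex matrices. Then the integral over the unitary group U(d) with respect to the Haar probability measure satisfies ∫ dU ⟨A (U† B U) C (U† D U)⟩ = ⟨AC⟩⟨B⟩⟨D⟩ + ⟨A⟩⟨C⟩⟨BD⟩ − ⟨A⟩⟨B⟩⟨C⟩⟨D⟩ − ⟨AC⟩_c ⟨BD⟩_c /(d² − 1). -/
open Matrix MeasureTheory

noncomputable instance (d : ℕ) : MeasurableSpace (Matrix.unitaryGroup (Fin d) ℂ) := borel _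

/-- normalized trace -/
noncomputable def nTrace {d : ℕ} (X : Matrix (Fin d) (Fin d) ℂ) : ℂ := X.trace / d

/-- connected correlator -/
noncomputable def conn {d : ℕ} (X Y : Matrix (Fin d) (Fin d) ℂ) : ℂ :=
  nTrace (X * Y) - nTrace X * nTrace Y

theorem aux_lie {d : ℕ} (F : Matrix (Fin d) (Fin d) ℂ →ₗ[ℂ] Matrix (Fin d) (Fin d) ℂ →ₗ[ℂ] ℂ)
    (hF : ∀ V : Matrix.unitaryGroup (Fin d) ℂ, ∀ B D : Matrix (Fin d) (Fin d) ℂ,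
      F ((V : Matrix (Fin d) (Fin d) ℂ)ᴴ * B * V) ((V : Matrix (Fin d) (Fin d) ℂ)ᴴ * D * V) = F B D)
    (P : Matrix (Fin d) (Fin d) ℂ) (hP : P * P = P) (hPH : Pᴴ = P)
    (B D : Matrix (Fin d) (Fin d) ℂ) :
    F (P * B) D + F B (P * D) = F (B * P) D + F B (D * P) := by
  have key : ∀ z : ℂ, star z * z = 1 →
      (z - 1) * (F (P * B) D + F B (P * D)) + (z - 1) ^ 2 * F (P * B) (P * D) =
      (z - 1) * (F (B * P) D + F B (D * P)) + (z - 1) ^ 2 * F (B * P) (D * P) := by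
    intro z hz
    have hVV : (1 + (z - 1) • P)ᴴ * (1 + (z - 1) • P) = 1 := by
      simp only [conjTranspose_add, conjTranspose_one, conjTranspose_smul, hPH, add_mul, mul_add,
        one_mul, mul_one, smul_mul_assoc, mul_smul_comm, hP, smul_smul]
      have : star (z - 1) + ((z - 1) + star (z - 1) * (z - 1)) = 0 := by
        simp only [star_sub, star_one]; linear_combination hz
      rw [add_assoc]
      have h2 : (star (z - 1) • P + (z - 1) • (P + star (z - 1) • P)) = (0 : ℂ) • P := by
        rw [← this]; module
      rw [h2]; simp
    have hV : (1 + (z - 1) • P) ∈ Matrix.unitaryGroup (Fin d) ℂ := by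
      rw [Matrix.mem_unitaryGroup_iff']; exact hVV
    have h := hF ⟨_, hV⟩ ((1 + (z - 1) • P) * B) ((1 + (z - 1) • P) * D)
    simp only [← Matrix.mul_assoc, hVV, Matrix.one_mul] at h
    simp only [add_mul, mul_add, one_mul, mul_one, smul_mul_assoc, mul_smul_comm, map_add, map_smul,
      LinearMap.add_apply, LinearMap.smul_apply, smul_eq_mul] at h
    linear_combination -h
  have h1 := key (-1) (by simp)
  have h2 := key Complex.I (by simp)
  have hI : (Complex.I - 1) ≠ 0 := by
    intro h; have := congrArg Complex.im h; simp at this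
  have hI2 : (Complex.I + 1) ≠ 0 := by
    intro h; have := congrArg Complex.im h; simp at this
  have hII := Complex.I_mul_I
  apply mul_left_cancel₀ hI
  apply mul_left_cancel₀ hI2
  linear_combination (2 : ℂ) * h2 - (Complex.I - 1) ^ 2 / 2 * h1

theorem aux_lie2 {d : ℕ} (F : Matrix (Fin d) (Fin d) ℂ →ₗ[ℂ] Matrix (Fin d) (Fin d) ℂ →ₗ[ℂ] ℂ)
    (hF : ∀ V : Matrix.unitaryGroup (Fin d) ℂ, ∀ B D : Matrix (Fin d) (Fin d) ℂ,
      F ((V : Matrix (Fin d) (Fin d) ℂ)ᴴ * B * V) ((V : Matrix (Fin d) (Fin d) ℂ)ᴴ * D * V) = F B D)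
    (p q : Fin d) (B D : Matrix (Fin d) (Fin d) ℂ) :
    F (single p q 1 * B) D + F B (single p q 1 * D) =
      F (B * single p q 1) D + F B (D * single p q 1) := by
  have hd : ∀ p : Fin d, F (single p p 1 * B) D + F B (single p p 1 * D) =
      F (B * single p p 1) D + F B (D * single p p 1) := fun p =>
    aux_lie F hF _ (by simp) (by simp) B D
  by_cases hpq : p = q
  · subst hpq; exact hd p
  have hu : ∀ u : ℂ, star u * u = 1 → 
      u * (F (single p q 1 * B) D + F B (single p q 1 * D)) +
        star u * (F (single q p 1 * B) D + F B (single q p 1 * D)) =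
      u * (F (B * single p q 1) D + F B (D * single p q 1)) +
        star u * (F (B * single q p 1) D + F B (D * single q p 1)) := by
    intro u hu
    have h := aux_lie F hF ((1 / 2 : ℂ) • (single p p 1 + single q q 1 + u • single p q 1
      + star u • single q p 1)) (by
        have hu' : u * star u = 1 := by rw [mul_comm]; exact hu
        simp only [add_mul, mul_add, smul_mul_assoc, mul_smul_comm, smul_add,
          single_mul_single_same, mul_one,
          single_mul_single_of_ne _ _ _ _ hpq, single_mul_single_of_ne _ _ _ _ (Ne.symm hpq),
          smul_zero, add_zero, zero_add, smul_smul]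
        match_scalars <;> first | ring1 | linear_combination (1/4 : ℂ) * hu)
      (by simp [conjTranspose_single]; abel) B D
    simp only [add_mul, mul_add, smul_mul_assoc, mul_smul_comm, map_add, map_smul,
      LinearMap.add_apply, LinearMap.smul_apply, smul_eq_mul] at h
    linear_combination 2 * h - hd p - hd q
  have h1 := hu 1 (by simp)
  have h2 := hu Complex.I (by simp)
  simp only [star_one, Complex.star_def, Complex.conj_I] at h1 h2
  have hII := Complex.I_mul_I
  linear_combination (1/2 : ℂ) * h1 - Complex.I / 2 * h2 + (1/2 : ℂ) * hII * ((F (single p q 1 * B) D + F B (single p q 1 * D)) -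
        (F (single q p 1 * B) D + F B (single q p 1 * D)) -
      (F (B * single p q 1) D + F B (D * single p q 1)) +
        (F (B * single q p 1) D + F B (D * single q p 1)))

theorem aux_tensor {d : ℕ} (hd : 2 ≤ d) (f : Fin d → Fin d → Fin d → Fin d → ℂ)
    (h : ∀ p q i j k l, (if q = i then f p j k l else 0) + (if q = k then f i j p l else 0) =
      (if j = p then f i q k l else 0) + (if l = p then f i j k q else 0)) :
    ∃ s t : ℂ, (d : ℂ) * s = ∑ i, ∑ k, f i i k k ∧ (d : ℂ) * t = ∑ q, ∑ j, f q j j q ∧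
      ∀ p j k l, ((d : ℂ) ^ 2 - 1) * f p j k l =
        d * ((if j = p then (if k = l then s else 0) else 0) +
          (if l = p then (if j = k then t else 0) else 0)) -
        (if j = k then (if p = l then s else 0) else 0) -
        (if l = k then (if j = p then t else 0) else 0) := by
  let o : Fin d := ⟨0, by omega⟩
  have hS : ∀ p q k l, (if q = k then ∑ i, f i i p l else 0) =
      (if l = p then ∑ i, f i i k q else 0) := by
    intro p q k l
    have := Finset.sum_congr rfl (fun i (_ : i ∈ Finset.univ) => h p q i i k l)
    simp only [Finset.sum_add_distrib, Finset.sum_ite_eq, Finset.sum_ite_eq', Finset.mem_univ,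
      if_true] at this
    split_ifs at this ⊢ <;> simp_all
  have hT : ∀ p q j k, (if q = k then ∑ i, f i j p i else 0) =
      (if j = p then ∑ i, f i q k i else 0) := by
    intro p q j k
    have := Finset.sum_congr rfl (fun i (_ : i ∈ Finset.univ) => h p q i j k i)
    simp only [Finset.sum_add_distrib, Finset.sum_ite_eq, Finset.sum_ite_eq', Finset.mem_univ,
      if_true] at this
    split_ifs at this ⊢ <;> simp_all
    linear_combination this
  have hS' : ∀ p l, ∑ i, f i i p l = if p = l then ∑ i, f i i o o else 0 := by
    intro p l
    have := hS p o o l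
    simpa [eq_comm] using this
  have hT' : ∀ j p, ∑ i, f i j p i = if j = p then ∑ i, f i o o i else 0 := by
    intro p l
    have := hT l o p o
    simpa using this
  refine ⟨∑ i, f i i o o, ∑ i, f i o o i, ?_, ?_, ?_⟩
  · rw [Finset.sum_comm, Finset.sum_congr rfl (fun k _ => hS' k k)]; simp
  · rw [Finset.sum_comm, Finset.sum_congr rfl (fun k _ => hT' k k)]; simp
  have hD : ∀ p j k l, (d : ℂ) * f p j k l + f k j p l =
      (if j = p then ∑ i, f i i k l else 0) + (if l = p then ∑ i, f i j k i else 0) := by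
    intro p j k l
    have := Finset.sum_congr rfl (fun i (_ : i ∈ Finset.univ) => h p i i j k l)
    simp only [Finset.sum_add_distrib, Finset.sum_ite_eq, Finset.sum_ite_eq', Finset.mem_univ,
      if_true] at this
    simp at this
    rw [this]
  intro p j k l
  have h1 := hD p j k l
  have h2 := hD k j p l
  rw [hS', hT'] at h1 h2
  linear_combination (d : ℂ) * h1 - h2

theorem aux_bilin {d : ℕ} (hd : 2 ≤ d)
    (F : Matrix (Fin d) (Fin d) ℂ →ₗ[ℂ] Matrix (Fin d) (Fin d) ℂ →ₗ[ℂ] ℂ)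
    (hF : ∀ V : Matrix.unitaryGroup (Fin d) ℂ, ∀ B D : Matrix (Fin d) (Fin d) ℂ,
      F ((V : Matrix (Fin d) (Fin d) ℂ)ᴴ * B * V) ((V : Matrix (Fin d) (Fin d) ℂ)ᴴ * D * V) = F B D)
    (B D : Matrix (Fin d) (Fin d) ℂ) :
    (d : ℂ) * ((d : ℂ) ^ 2 - 1) * F B D =
      d * (F 1 1 * (B.trace * D.trace) +
        (∑ q, ∑ j, F (single q j 1) (single j q 1)) * (B * D).trace) -
      F 1 1 * (B * D).trace -
        (∑ q, ∑ j, F (single q j 1) (single j q 1)) * (B.trace * D.trace) := by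
  obtain ⟨s, t, hs, ht, hf⟩ := aux_tensor hd
    (fun i j k l => F (single i j 1) (single k l 1)) (by
      intro p q i j k l
      have h := aux_lie2 F hF p q (single i j 1) (single k l 1)
      have e : ∀ a b c e : Fin d, (single a b (1 : ℂ) * single c e 1 : Matrix (Fin d) (Fin d) ℂ) =
          if b = c then single a e 1 else 0 := by
        intro a b c e
        split_ifs with hbc
        · subst hbc; simp
        · exact single_mul_single_of_ne _ _ _ _ hbc _
      simp only [e] at h
      convert h using 2 <;> split_ifs <;> simp)
  have hexp : F B D = ∑ p, ∑ j, ∑ k, ∑ l, B p j * D k l * F (single p j 1) (single k l 1) := by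
    have e : ∀ M : Matrix (Fin d) (Fin d) ℂ, M = ∑ i, ∑ j, M i j • single i j (1 : ℂ) := by
      intro M
      conv_lhs => rw [matrix_eq_sum_single M]
      simp [smul_single]
    conv_lhs => rw [e B]
    simp only [map_sum, map_smul, LinearMap.sum_apply, LinearMap.smul_apply, smul_eq_mul]
    refine Finset.sum_congr rfl fun p _ => Finset.sum_congr rfl fun j _ => ?_
    conv_lhs => rw [e D]
    simp only [map_sum, map_smul, smul_eq_mul, Finset.mul_sum, mul_assoc]
  have h11 : F 1 1 = ∑ i, ∑ k, F (single i i 1) (single k k 1) := by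
    have e : (1 : Matrix (Fin d) (Fin d) ℂ) = ∑ i, single i i (1 : ℂ) := by
      ext a b
      simp [Matrix.sum_apply, one_apply, single_apply, ite_and]
    conv_lhs => rw [e]
    simp only [map_sum, LinearMap.sum_apply]
    rw [Finset.sum_comm]
  rw [h11, ← hs, ← ht]
  have : ((d : ℂ) ^ 2 - 1) * F B D = d * (s * (B.trace * D.trace) + t * (B * D).trace)
      - s * (B * D).trace - t * (B.trace * D.trace) := by
    have hT1 : B.trace * D.trace = ∑ p, ∑ j, ∑ k, ∑ l, B p j * D k l *
        (if j = p then (if k = l then 1 else 0) else 0) := by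
      simp [Matrix.trace, Finset.sum_mul_sum]
    have hT2 : (B * D).trace = ∑ p, ∑ j, ∑ k, ∑ l, B p j * D k l *
        (if l = p then (if j = k then 1 else 0) else 0) := by
      simp [Matrix.trace, Matrix.mul_apply]
    rw [hexp, hT1, hT2]
    simp only [Finset.mul_sum, ← Finset.sum_add_distrib, ← Finset.sum_sub_distrib]
    refine Finset.sum_congr rfl fun p _ => Finset.sum_congr rfl fun j _ =>
      Finset.sum_congr rfl fun k _ => Finset.sum_congr rfl fun l _ => ?_
    have := hf p j k l
    simp only [eq_comm (a := l) (b := k), eq_comm (a := p) (b := l)] at this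
    have g : ∀ (P Q : Prop) [Decidable P] [Decidable Q] (x : ℂ),
      (if P then (if Q then x else 0) else 0) = x * (if P then (if Q then 1 else 0) else 0) := by
      intros; split_ifs <;> simp
    rw [g _ _ s, g _ _ s, g _ _ t, g _ _ t] at this
    have c : (if j = k then (if l = p then (1 : ℂ) else 0) else 0) = (if l = p then (if j = k then (1 : ℂ) else 0) else 0) := by
      split_ifs <;> rfl
    have c2 : (if k = l then (if j = p then (1 : ℂ) else 0) else 0) = (if j = p then (if k = l then (1 : ℂ) else 0) else 0) := by
      split_ifs <;> rfl
    rw [c, c2] at this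
    linear_combination B p j * D k l * this
  linear_combination (d : ℂ) * this

instance aux_borel (d : ℕ) : BorelSpace (Matrix.unitaryGroup (Fin d) ℂ) := ⟨rfl⟩

instance aux_compact (d : ℕ) : CompactSpace (Matrix.unitaryGroup (Fin d) ℂ) := by
  refine isCompact_iff_compactSpace.mp ?_
  have h1 : IsClosed ((Matrix.unitaryGroup (Fin d) ℂ : Set (Matrix (Fin d) (Fin d) ℂ))) :=
    isClosed_unitary
  have h2 : IsCompact (Set.pi Set.univ fun _ : Fin d => Set.pi Set.univ fun _ : Fin d =>
      Metric.closedBall (0 : ℂ) 1) :=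
    isCompact_univ_pi fun _ => isCompact_univ_pi fun _ => isCompact_closedBall _ _
  refine IsCompact.of_isClosed_subset h2 h1 ?_
  intro U hU i _ j _
  simpa using entry_norm_bound_of_unitary hU i j

theorem aux_int {d : ℕ} (μ : Measure (Matrix.unitaryGroup (Fin d) ℂ)) [IsProbabilityMeasure μ]
    (A B C D : Matrix (Fin d) (Fin d) ℂ) :
    Integrable (fun U : Matrix.unitaryGroup (Fin d) ℂ =>
      (A * ((U : Matrix (Fin d) (Fin d) ℂ)ᴴ * B * (U : Matrix (Fin d) (Fin d) ℂ)) * C *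
          ((U : Matrix (Fin d) (Fin d) ℂ)ᴴ * D * (U : Matrix (Fin d) (Fin d) ℂ))).trace) μ := by
  apply Continuous.integrable_of_hasCompactSupport
  · have : Continuous fun U : Matrix.unitaryGroup (Fin d) ℂ => (U : Matrix (Fin d) (Fin d) ℂ) :=
      continuous_subtype_val
    have h2 := this.matrix_conjTranspose
    refine Continuous.matrix_trace ?_
    fun_prop
  · exact HasCompactSupport.of_compactSpace _

/-- the bilinear form -/
noncomputable def auxF {d : ℕ} (μ : Measure (Matrix.unitaryGroup (Fin d) ℂ)) [IsProbabilityMeasure μ]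
    (A C : Matrix (Fin d) (Fin d) ℂ) :
    Matrix (Fin d) (Fin d) ℂ →ₗ[ℂ] Matrix (Fin d) (Fin d) ℂ →ₗ[ℂ] ℂ :=
  LinearMap.mk₂ ℂ (fun B D => ∫ U : Matrix.unitaryGroup (Fin d) ℂ,
      (A * ((U : Matrix (Fin d) (Fin d) ℂ)ᴴ * B * (U : Matrix (Fin d) (Fin d) ℂ)) * C *
          ((U : Matrix (Fin d) (Fin d) ℂ)ᴴ * D * (U : Matrix (Fin d) (Fin d) ℂ))).trace ∂μ)
    (by
      intro B B' D
      rw [← integral_add (aux_int μ A B C D) (aux_int μ A B' C D)]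
      simp only [mul_add, add_mul, Matrix.trace_add])
    (by
      intro c B D
      rw [smul_eq_mul, ← integral_const_mul]
      simp only [mul_smul_comm, smul_mul_assoc, Matrix.trace_smul, smul_eq_mul])
    (by
      intro B D D'
      rw [← integral_add (aux_int μ A B C D) (aux_int μ A B C D')]
      simp only [mul_add, add_mul, Matrix.trace_add])
    (by
      intro c B D
      rw [smul_eq_mul, ← integral_const_mul]
      simp only [mul_smul_comm, smul_mul_assoc, Matrix.trace_smul, smul_eq_mul])

theorem stmt0 (d : ℕ) (hd : 2 ≤ d) (A B C D : Matrix (Fin d) (Fin d) ℂ)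
    (μ : Measure (Matrix.unitaryGroup (Fin d) ℂ)) [μ.IsHaarMeasure] [IsProbabilityMeasure μ] :
    ∫ U : Matrix.unitaryGroup (Fin d) ℂ,
        nTrace (A * ((U : Matrix (Fin d) (Fin d) ℂ)ᴴ * B * (U : Matrix (Fin d) (Fin d) ℂ)) * C *
          ((U : Matrix (Fin d) (Fin d) ℂ)ᴴ * D * (U : Matrix (Fin d) (Fin d) ℂ))) ∂μ =
      nTrace (A * C) * nTrace B * nTrace D + nTrace A * nTrace C * nTrace (B * D) -
        nTrace A * nTrace B * nTrace C * nTrace D -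
        conn A C * conn B D / (d ^ 2 - 1) := by
  have hUU : ∀ U : Matrix.unitaryGroup (Fin d) ℂ,
      (U : Matrix (Fin d) (Fin d) ℂ)ᴴ * (U : Matrix (Fin d) (Fin d) ℂ) = 1 := fun U =>
    Matrix.mem_unitaryGroup_iff'.mp U.2
  have hUU' : ∀ U : Matrix.unitaryGroup (Fin d) ℂ,
      (U : Matrix (Fin d) (Fin d) ℂ) * (U : Matrix (Fin d) (Fin d) ℂ)ᴴ = 1 := fun U =>
    Matrix.mem_unitaryGroup_iff.mp U.2
  have hinv : ∀ V : Matrix.unitaryGroup (Fin d) ℂ, ∀ B D : Matrix (Fin d) (Fin d) ℂ,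
      auxF μ A C ((V : Matrix (Fin d) (Fin d) ℂ)ᴴ * B * V)
        ((V : Matrix (Fin d) (Fin d) ℂ)ᴴ * D * V) = auxF μ A C B D := by
    intro V B D
    simp only [auxF, LinearMap.mk₂_apply]
    conv_rhs => rw [← integral_mul_left_eq_self (μ := μ) _ V]
    simp only [Submonoid.coe_mul, conjTranspose_mul, Matrix.mul_assoc]
  have h11 : auxF μ A C 1 1 = (A * C).trace := by
    simp [auxF, hUU]
  have hss : ∀ X : Matrix (Fin d) (Fin d) ℂ,
      ∑ q, ∑ j, single q j (1 : ℂ) * X * single j q 1 = X.trace • (1 : Matrix (Fin d) (Fin d) ℂ) := by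
    intro X
    ext a b
    simp only [Matrix.sum_apply, single_mul_mul_single]
    simp [Matrix.trace, one_apply, single_apply, ite_and, Finset.sum_ite_irrel]
  have hsw : (∑ q, ∑ j, auxF μ A C (single q j 1) (single j q 1)) = A.trace * C.trace := by
    simp only [auxF, LinearMap.mk₂_apply]
    rw [Finset.sum_congr rfl fun q _ => (integral_finsetSum _ fun j _ => aux_int μ A _ C _).symm,
      ← integral_finsetSum _ fun q _ => integrable_finsetSum _ fun j _ => aux_int μ A _ C _]
    have : ∀ U : Matrix.unitaryGroup (Fin d) ℂ, ∑ q, ∑ j,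
      (A * ((U : Matrix (Fin d) (Fin d) ℂ)ᴴ * single q j 1 * (U : Matrix (Fin d) (Fin d) ℂ)) * C *
          ((U : Matrix (Fin d) (Fin d) ℂ)ᴴ * single j q 1 * (U : Matrix (Fin d) (Fin d) ℂ))).trace
        = A.trace * C.trace := by
      intro U
      have e : ∑ q, ∑ j,
        (A * ((U : Matrix (Fin d) (Fin d) ℂ)ᴴ * single q j 1 * (U : Matrix (Fin d) (Fin d) ℂ)) * C *
          ((U : Matrix (Fin d) (Fin d) ℂ)ᴴ * single j q 1 * (U : Matrix (Fin d) (Fin d) ℂ))) =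
        A * (U : Matrix (Fin d) (Fin d) ℂ)ᴴ * (∑ q, ∑ j, single q j (1 : ℂ) *
          ((U : Matrix (Fin d) (Fin d) ℂ) * C * (U : Matrix (Fin d) (Fin d) ℂ)ᴴ) * single j q 1) *
          (U : Matrix (Fin d) (Fin d) ℂ) := by
        simp only [Finset.mul_sum, Finset.sum_mul, Matrix.mul_assoc]
      simp only [← Matrix.trace_sum]
      have e2 : ((U : Matrix (Fin d) (Fin d) ℂ) * C * (U : Matrix (Fin d) (Fin d) ℂ)ᴴ).trace =
          C.trace := by
        rw [Matrix.trace_mul_comm, ← Matrix.mul_assoc, hUU, Matrix.one_mul]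
      rw [e, hss, e2, mul_smul_comm, smul_mul_assoc, Matrix.mul_one, Matrix.mul_assoc, hUU,
        Matrix.mul_one, Matrix.trace_smul, smul_eq_mul, mul_comm]
    simp [this]
  have key := aux_bilin hd (auxF μ A C) hinv B D
  rw [h11, hsw] at key
  have hL : ∫ U : Matrix.unitaryGroup (Fin d) ℂ,
        nTrace (A * ((U : Matrix (Fin d) (Fin d) ℂ)ᴴ * B * (U : Matrix (Fin d) (Fin d) ℂ)) * C *
          ((U : Matrix (Fin d) (Fin d) ℂ)ᴴ * D * (U : Matrix (Fin d) (Fin d) ℂ))) ∂μ =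
      auxF μ A C B D / d := by
    simp only [nTrace, auxF, LinearMap.mk₂_apply]
    rw [integral_div]
  rw [hL]
  have hd0 : (d : ℂ) ≠ 0 := by
    norm_cast; omega
  have hd1 : (d : ℂ) ^ 2 - 1 ≠ 0 := by
    rw [sub_ne_zero]
    norm_cast
    nlinarith
  have hv := eq_div_of_mul_eq (mul_ne_zero hd0 hd1) ((mul_comm _ _).trans key)
  rw [hv]
  simp only [nTrace, conn]
  field_simp
  ring
end

section
/- For every positive integer k there exist constants c > 0 and ε₀ > 0 (depending only on k) such that the following holds for every n ≥ k + 2: let H = Σ_{i∈ℤ/nℤ} H_i be a nearest-neighbor Hamiltonian on n qubits with ‖H_i‖ ≤ 1 for all i, let X be an operator supported on at most k consecutive sites, and let ε < ε' be real numbers. Then ‖P(−∞,ε) X P(ε′,+∞)‖ ≤ c ‖X‖ e^{−(ε′−ε)/ε₀}, where P(a,b) := Σ_{j : a ≤ E_j < b} |j⟩⟨j| is the spectral projector of H onto the energy window [a,b). -/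
open Matrix Filter Finset
open scoped Classical

/-- computational basis configurations of `n` qubits -/
abbrev Cfg (n : ℕ) := Fin n → Fin 2

/-- the site following `i` in the cyclic order on `ℤ/nℤ` -/
def nxt {n : ℕ} (i : Fin n) : Fin n :=
  ⟨(i.1 + 1) % n, Nat.mod_lt _ (Nat.lt_of_le_of_lt (Nat.zero_le _) i.2)⟩

/-- the operator acting as the 4×4 matrix `h` on the two neighboring sites `i, i+1`
and as the identity elsewhere -/
noncomputable def twoSite (n : ℕ) (i : Fin n)
    (h : Matrix (Fin 2 × Fin 2) (Fin 2 × Fin 2) ℂ) : Matrix (Cfg n) (Cfg n) ℂ :=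
  fun x y =>
    if ∀ j : Fin n, j ≠ i → j ≠ nxt i → x j = y j then
      h (x i, x (nxt i)) (y i, y (nxt i))
    else 0

/-- the ℓ²→ℓ² operator norm of a matrix -/
noncomputable def opNorm {d : Type*} [Fintype d] [DecidableEq d] (X : Matrix d d ℂ) : ℝ :=
  ‖LinearMap.toContinuousLinearMap (Matrix.toEuclideanLin X)‖

/-- the window of `k` consecutive sites starting at `i0` -/
def window {n : ℕ} (i0 : Fin n) (k : ℕ) : Finset (Fin n) :=
  (Finset.range k).image fun t =>
    (⟨(i0.1 + t) % n, Nat.mod_lt _ (Nat.lt_of_le_of_lt (Nat.zero_le _) i0.2)⟩ : Fin n)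

/-- `M` acts as the identity outside the set `S` of sites, i.e. `M` is the conjugation, by the
permutation of tensor factors moving the sites of `S` to the front, of `m ⊗ I`. -/
def SupportedOn {n : ℕ} (S : Finset (Fin n)) (M : Matrix (Cfg n) (Cfg n) ℂ) : Prop :=
  (∀ x y : Cfg n, ¬(∀ j ∉ S, x j = y j) → M x y = 0) ∧
  (∀ x y x' y' : Cfg n, (∀ j ∈ S, x j = x' j) → (∀ j ∈ S, y j = y' j) →
    (∀ j ∉ S, x j = y j) → (∀ j ∉ S, x' j = y' j) → M x y = M x' y')

/-- `M` is supported on at most `k` consecutive sites -/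
def SupportedOnConsec {n : ℕ} (k : ℕ) (M : Matrix (Cfg n) (Cfg n) ℂ) : Prop :=
  ∃ i0 : Fin n, SupportedOn (window i0 k) M

open scoped Matrix.Norms.L2Operator

lemma opNorm_eq_norm {d : Type*} [Fintype d] [DecidableEq d] (X : Matrix d d ℂ) :
    opNorm X = ‖X‖ := by
  rw [Matrix.l2_opNorm_def]
  rfl

/-- operators with disjoint supports commute -/
lemma commute_of_disjoint {n : ℕ} {S R : Finset (Fin n)} {A B : Matrix (Cfg n) (Cfg n) ℂ}
    (hA : SupportedOn S A) (hB : SupportedOn R B) (hd : ∀ j ∈ S, j ∉ R) : A * B = B * A := by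
  ext x y
  rw [Matrix.mul_apply, Matrix.mul_apply]
  rw [Finset.sum_eq_single (fun j => if j ∈ S then y j else x j),
    Finset.sum_eq_single (fun j => if j ∈ S then x j else y j)]
  · by_cases hxy : ∀ j, j ∉ S → j ∉ R → x j = y j
    · have h1 : A x (fun j => if j ∈ S then y j else x j) =
          A (fun j => if j ∈ S then x j else y j) y := by
        apply hA.2 <;> intro j hj <;> simp [hj]
      have h2 : B (fun j => if j ∈ S then y j else x j) y =
          B x (fun j => if j ∈ S then x j else y j) := by
        apply hB.2 <;> intro j hj <;> by_cases hS : j ∈ S <;> simp [hS]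
        · exact absurd hj (hd j hS)
        · exact absurd hj (hd j hS)
        · exact hxy j hS hj
        · exact hxy j hS hj
      rw [h1, h2, mul_comm]
    · push Not at hxy
      obtain ⟨j, hS, hR, hne⟩ := hxy
      rw [hB.1 _ y, hB.1 x _]
      · simp
      · intro h
        have := h j hR
        simp [hS] at this
        exact hne this
      · intro h
        have := h j hR
        simp [hS] at this
        exact hne this
  · intro z _ hz
    obtain ⟨j, hj⟩ := Function.ne_iff.mp hz
    by_cases hS : j ∈ S
    · rw [hB.1 x z, zero_mul]
      intro h
      apply hj
      simp [hS, h j (hd j hS)]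
    · rw [hA.1 z y, mul_zero]
      intro h
      apply hj
      simp [hS, h j hS]
  · simp
  · intro z _ hz
    obtain ⟨j, hj⟩ := Function.ne_iff.mp hz
    by_cases hS : j ∈ S
    · rw [hB.1 z y, mul_zero]
      intro h
      apply hj
      simp [hS, h j (hd j hS)]
    · rw [hA.1 x z, zero_mul]
      intro h
      apply hj
      simp [hS, h j hS]
  · simp

lemma supportedOn_twoSite {n : ℕ} (i : Fin n) (h : Matrix (Fin 2 × Fin 2) (Fin 2 × Fin 2) ℂ) :
    SupportedOn {i, nxt i} (twoSite n i h) := by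
  constructor
  · intro x y hxy
    unfold twoSite
    rw [if_neg]
    intro hc
    apply hxy
    intro j hj
    simp at hj
    exact hc j hj.1 hj.2
  · intro x y x' y' h1 h2 h3 h4
    unfold twoSite
    rw [if_pos, if_pos]
    · rw [h1 i (by simp), h1 (nxt i) (by simp), h2 i (by simp), h2 (nxt i) (by simp)]
    · intro j a b
      exact h4 j (by simp [a, b])
    · intro j a b
      exact h3 j (by simp [a, b])

/-- the site preceding `i` -/
def prv {n : ℕ} (i : Fin n) : Fin n :=
  ⟨(i.1 + (n - 1)) % n, Nat.mod_lt _ (Nat.lt_of_le_of_lt (Nat.zero_le _) i.2)⟩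

lemma prv_nxt {n : ℕ} (i : Fin n) : prv (nxt i) = i := by
  ext
  have := i.2
  simp only [prv, nxt]
  rw [Nat.mod_add_mod, show i.1 + 1 + (n - 1) = i.1 + n by omega, Nat.add_mod_right,
    Nat.mod_eq_of_lt this]

/-- commutator with `H` -/
def cm {A : Type*} [Ring A] (H Y : A) : A := Y * H - H * Y

lemma cm_iter_sum {A ι : Type*} [Ring A] (H : A) (m : ℕ) (T : Finset ι) (f : ι → A) :
    (cm H)^[m] (∑ i ∈ T, f i) = ∑ i ∈ T, (cm H)^[m] (f i) := by
  induction m generalizing f with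
  | zero => simp
  | succ m ih =>
    simp only [Function.iterate_succ, Function.comp]
    rw [← ih]
    congr 1
    simp [cm, Finset.sum_mul, Finset.mul_sum]

lemma cm_iter_bound {A : Type*} [NormedRing A] {n : ℕ} (h : Fin n → A) (hn : ∀ i, ‖h i‖ ≤ 1)
    (hc : ∀ i j, j ∉ ({i, nxt i, prv i} : Finset (Fin n)) → h j * h i = h i * h j)
    (m : ℕ) : ∀ (T : Finset (Fin n)) (t : ℕ) (Y : A), (∀ j ∉ T, h j * Y = Y * h j) → T.card ≤ t →
      ‖(cm (∑ i, h i))^[m] Y‖ ≤ (∏ j ∈ Finset.range m, (2 * ((t : ℝ) + 3 * j))) * ‖Y‖ := by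
  induction m with
  | zero => intro T t Y _ _; simp
  | succ m ih =>
    intro T t Y hY ht
    have e1 : cm (∑ i, h i) Y = ∑ i ∈ T, cm (h i) Y := by
      have : cm (∑ i, h i) Y = ∑ i, cm (h i) Y := by
        simp [cm, Finset.sum_mul, Finset.mul_sum]
      rw [this]
      symm
      apply Finset.sum_subset (Finset.subset_univ _)
      intro j _ hj
      simp [cm, hY j hj]
    rw [Function.iterate_succ_apply, e1, cm_iter_sum]
    have key : ∀ i ∈ T, ‖(cm (∑ i, h i))^[m] (cm (h i) Y)‖ ≤
        (∏ j ∈ Finset.range m, (2 * (((t + 3 : ℕ) : ℝ) + 3 * j))) * (2 * ‖Y‖) := by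
      intro i _
      refine (ih (T ∪ {i, nxt i, prv i}) (t + 3) (cm (h i) Y) ?_ ?_).trans ?_
      · intro j hj
        rw [Finset.mem_union, not_or] at hj
        have a := hY j hj.1
        have b := hc i j hj.2
        have c1 : h j * (Y * h i) = Y * h i * h j := by
          rw [← mul_assoc, a, mul_assoc, b, mul_assoc]
        have c2 : h j * (h i * Y) = h i * Y * h j := by
          rw [← mul_assoc, b, mul_assoc, a, mul_assoc]
        simp only [cm, mul_sub, sub_mul, c1, c2]
      · refine (Finset.card_union_le _ _).trans ?_
        have := Finset.card_le_three (a := i) (b := nxt i) (c := prv i)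
        omega
      · gcongr
        · unfold cm
          have a : ‖Y * h i‖ ≤ ‖Y‖ * 1 := (norm_mul_le _ _).trans (by gcongr; exact hn i)
          have b : ‖h i * Y‖ ≤ 1 * ‖Y‖ := (norm_mul_le _ _).trans (by gcongr; exact hn i)
          have := norm_sub_le (Y * h i) (h i * Y)
          linarith
    refine (norm_sum_le_of_le _ key).trans ?_
    rw [Finset.sum_const, nsmul_eq_mul, Finset.prod_range_succ']
    have e2 : ∏ j ∈ Finset.range m, (2 * (((t + 3 : ℕ) : ℝ) + 3 * j)) =
        ∏ j ∈ Finset.range m, (2 * ((t : ℝ) + 3 * ((j + 1 : ℕ) : ℝ))) := by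
      apply Finset.prod_congr rfl
      intro j _
      push_cast
      ring
    rw [e2]
    have h0 : 0 ≤ ∏ j ∈ Finset.range m, (2 * ((t : ℝ) + 3 * ((j + 1 : ℕ) : ℝ))) :=
      Finset.prod_nonneg fun j _ => by positivity
    have ht' : (T.card : ℝ) ≤ t := by exact_mod_cast ht
    calc _ ≤ (t : ℝ) * ((∏ j ∈ Finset.range m, (2 * ((t : ℝ) + 3 * ((j + 1 : ℕ) : ℝ)))) *
          (2 * ‖Y‖)) := by gcongr
      _ = _ := by push_cast; ring

lemma prod_bound (t m : ℕ) :
    ∏ j ∈ Finset.range m, (2 * ((t : ℝ) + 3 * j)) ≤ 12 ^ m * 2 ^ t * m.factorial := by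
  have h1 : ∏ j ∈ Finset.range m, (2 * ((t : ℝ) + 3 * j)) ≤
      ∏ j ∈ Finset.range m, (6 * ((t + 1 + j : ℕ) : ℝ)) := by
    apply Finset.prod_le_prod
    · intro j _; positivity
    · intro j _
      push_cast
      have : (0 : ℝ) ≤ t := by positivity
      linarith
  refine h1.trans ?_
  rw [Finset.prod_mul_distrib, ← Nat.cast_prod, ← Nat.ascFactorial_eq_prod_range,
    Nat.ascFactorial_eq_factorial_mul_choose]
  simp only [Finset.prod_const, Finset.card_range]
  have h2 : ((t + m).choose m : ℝ) ≤ 2 ^ (t + m) := by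
    exact_mod_cast Nat.choose_le_two_pow _ _
  push_cast
  calc (6 : ℝ) ^ m * (m.factorial * (t + m).choose m)
      ≤ 6 ^ m * (m.factorial * 2 ^ (t + m)) := by gcongr
    _ = _ := by
      rw [pow_add, show (12 : ℝ) = 6 * 2 by norm_num, mul_pow]; ring

lemma cm_iter_entries {d : Type*} [Fintype d] [DecidableEq d] (U : Matrix d d ℂ)
    (hU : U ∈ Matrix.unitaryGroup d ℂ) (E : d → ℝ) (H : Matrix d d ℂ)
    (hH : H = U * Matrix.diagonal (fun j => (E j : ℂ)) * Uᴴ) (X : Matrix d d ℂ) (m : ℕ) (a b : d) :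
    (Uᴴ * ((cm H)^[m] X) * U) a b = ((E b : ℂ) - E a) ^ m * (Uᴴ * X * U) a b := by
  have hU1 : Uᴴ * U = 1 := Matrix.mem_unitaryGroup_iff'.mp hU
  induction m with
  | zero => simp
  | succ m ih =>
    rw [Function.iterate_succ_apply']
    set Y := (cm H)^[m] X
    have : Uᴴ * cm H Y * U = (Uᴴ * Y * U) * Matrix.diagonal (fun j => (E j : ℂ)) -
        Matrix.diagonal (fun j => (E j : ℂ)) * (Uᴴ * Y * U) := by
      have e1 : Uᴴ * (Y * H) * U = Uᴴ * Y * U * Matrix.diagonal (fun j => (E j : ℂ)) * (Uᴴ * U) := by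
        rw [hH]; simp only [Matrix.mul_assoc]
      have e2 : Uᴴ * (H * Y) * U = (Uᴴ * U) * (Matrix.diagonal (fun j => (E j : ℂ)) * (Uᴴ * Y * U)) := by
        rw [hH]; simp only [Matrix.mul_assoc]
      rw [cm, Matrix.mul_sub, Matrix.sub_mul, e1, e2, hU1, Matrix.mul_one, Matrix.one_mul]
    rw [this, Matrix.sub_apply, Matrix.mul_diagonal, Matrix.diagonal_mul, ih]
    ring

lemma norm_conj_unitary {d : Type*} [Fintype d] [DecidableEq d] (U : Matrix d d ℂ)
    (hU : U ∈ Matrix.unitaryGroup d ℂ) (X : Matrix d d ℂ) : ‖U * X * Uᴴ‖ = ‖X‖ := by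
  have h' : Uᴴ ∈ unitary (Matrix d d ℂ) := Unitary.star_mem hU
  rw [CStarRing.norm_mul_mem_unitary _ h', CStarRing.norm_mem_unitary_mul _ hU]

lemma norm_conj_unitary' {d : Type*} [Fintype d] [DecidableEq d] (U : Matrix d d ℂ)
    (hU : U ∈ Matrix.unitaryGroup d ℂ) (X : Matrix d d ℂ) : ‖Uᴴ * X * U‖ = ‖X‖ := by
  have h' : Uᴴ ∈ unitary (Matrix d d ℂ) := Unitary.star_mem hU
  rw [CStarRing.norm_mul_mem_unitary _ hU, CStarRing.norm_mem_unitary_mul _ h']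

/-- the exponentially conjugated operator is bounded -/
lemma norm_exp_conj {d : Type*} [Fintype d] [DecidableEq d] (E : d → ℝ) (X : Matrix d d ℂ)
    (Y : ℕ → Matrix d d ℂ) (hY : ∀ m a b, Y m a b = ((E b : ℂ) - E a) ^ m * X a b)
    (C : ℝ) (hC : ∀ m, ‖Y m‖ ≤ 12 ^ m * C * m.factorial) :
    ‖(Matrix.of fun a b => Complex.exp ((1 / 24 : ℂ) * (E b - E a)) * X a b : Matrix d d ℂ)‖
      ≤ 2 * C := by
  have hs : HasSum (fun m : ℕ => (((1 / 24 : ℂ) ^ m / m.factorial) • Y m))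
      (Matrix.of fun a b => Complex.exp ((1 / 24 : ℂ) * (E b - E a)) * X a b : Matrix d d ℂ) := by
    refine Pi.hasSum.2 fun a => Pi.hasSum.2 fun b => ?_
    have := (NormedSpace.expSeries_div_hasSum_exp ((1 / 24 : ℂ) * (E b - E a))).mul_right (X a b)
    rw [← Complex.exp_eq_exp_ℂ] at this
    have hfe : (fun m : ℕ => (((1 / 24 : ℂ) ^ m / m.factorial) • Y m) a b) =
        fun m : ℕ => ((1 / 24 : ℂ) * (E b - E a)) ^ m / m.factorial * X a b := by
      funext m
      rw [Matrix.smul_apply, smul_eq_mul, hY, mul_pow]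
      ring
    rw [← hfe] at this
    exact this
  have hg : HasSum (fun m : ℕ => (1 / 2 : ℝ) ^ m * C) (2 * C) :=
    hasSum_geometric_two.mul_right C
  refine hs.norm_le_of_bounded hg fun m => ?_
  rw [norm_smul]
  have hf : (0 : ℝ) < m.factorial := by positivity
  have : ‖(1 / 24 : ℂ) ^ m / m.factorial‖ = (1 / 24 : ℝ) ^ m / m.factorial := by
    simp
  rw [this]
  calc _ ≤ (1 / 24 : ℝ) ^ m / m.factorial * (12 ^ m * C * m.factorial) := by
        gcongr; exact hC m
    _ = ((1 / 24 : ℝ) ^ m * 12 ^ m) * C := by field_simp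
    _ = _ := by rw [← mul_pow]; norm_num

theorem stmt10 (k : ℕ) (hk : 0 < k) :
    ∃ c : ℝ, 0 < c ∧ ∃ ε₀ : ℝ, 0 < ε₀ ∧
      ∀ n : ℕ, k + 2 ≤ n →
      ∀ h : Fin n → Matrix (Fin 2 × Fin 2) (Fin 2 × Fin 2) ℂ,
        (∀ i, (twoSite n i (h i)).IsHermitian) →
        (∀ i, opNorm (twoSite n i (h i)) ≤ 1) →
      ∀ U : Matrix (Cfg n) (Cfg n) ℂ, U ∈ Matrix.unitaryGroup (Cfg n) ℂ →
      ∀ E : Cfg n → ℝ,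
        (∑ i : Fin n, twoSite n i (h i)) = U * Matrix.diagonal (fun j => (E j : ℂ)) * Uᴴ →
      ∀ X : Matrix (Cfg n) (Cfg n) ℂ, SupportedOnConsec k X →
      ∀ ε ε' : ℝ, ε < ε' →
        opNorm ((U * Matrix.diagonal (fun j => if E j < ε then (1 : ℂ) else 0) * Uᴴ) * X *
            (U * Matrix.diagonal (fun j => if ε' ≤ E j then (1 : ℂ) else 0) * Uᴴ)) ≤
          c * opNorm X * Real.exp (-(ε' - ε) / ε₀) := by
  refine ⟨2 * 2 ^ (2 * k), by positivity, 24, by norm_num, ?_⟩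
  intro n _ h _ hn U hU E hH X hX ε ε' _
  obtain ⟨i0, hX⟩ := hX
  simp only [opNorm_eq_norm] at hn ⊢
  set g : Fin n → Matrix (Cfg n) (Cfg n) ℂ := fun i => twoSite n i (h i) with hg
  have hc : ∀ i j, j ∉ ({i, nxt i, prv i} : Finset (Fin n)) → g j * g i = g i * g j := by
    intro i j hj
    simp only [Finset.mem_insert, Finset.mem_singleton, not_or] at hj
    refine commute_of_disjoint (supportedOn_twoSite j (h j)) (supportedOn_twoSite i (h i)) ?_
    intro l hl hl'
    simp only [Finset.mem_insert, Finset.mem_singleton] at hl hl'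
    rcases hl with rfl | rfl
    · rcases hl' with h1 | h1
      · exact hj.1 h1
      · exact hj.2.1 h1
    · rcases hl' with h1 | h1
      · apply hj.2.2
        rw [← h1, prv_nxt]
      · apply hj.1
        rw [← prv_nxt j, h1, prv_nxt]
  have hwc : (window i0 k).card ≤ k := by
    unfold window
    exact Finset.card_image_le.trans (by simp)
  have hb : ∀ m, ‖(cm (∑ i, g i))^[m] X‖ ≤ 12 ^ m * (2 ^ (2 * k) * ‖X‖) * m.factorial := by
    intro m
    refine (cm_iter_bound g hn hc m (window i0 k ∪ (window i0 k).image prv) (2 * k) X ?_ ?_).trans ?_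
    · intro j hj
      rw [Finset.mem_union, not_or] at hj
      refine commute_of_disjoint (supportedOn_twoSite j (h j)) hX ?_
      intro l hl hl'
      simp only [Finset.mem_insert, Finset.mem_singleton] at hl
      rcases hl with rfl | rfl
      · exact hj.1 hl'
      · apply hj.2
        exact Finset.mem_image.2 ⟨_, hl', prv_nxt j⟩
    · refine (Finset.card_union_le _ _).trans ?_
      have : ((window i0 k).image prv).card ≤ (window i0 k).card := Finset.card_image_le
      omega
    · calc _ ≤ (12 ^ m * 2 ^ (2 * k) * m.factorial) * ‖X‖ := by
            gcongr; exact prod_bound _ _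
        _ = _ := by ring
  set X' := Uᴴ * X * U with hX'
  have hW := norm_exp_conj E X' (fun m => Uᴴ * ((cm (∑ i, g i))^[m] X) * U)
    (fun m a b => cm_iter_entries U hU E _ hH X m a b) (2 ^ (2 * k) * ‖X‖)
    (fun m => by rw [norm_conj_unitary' U hU]; exact hb m)
  set W : Matrix (Cfg n) (Cfg n) ℂ :=
    Matrix.of fun a b => Complex.exp ((1 / 24 : ℂ) * (E b - E a)) * X' a b with hWdef
  have e1 : (U * Matrix.diagonal (fun j => if E j < ε then (1 : ℂ) else 0) * Uᴴ) * X *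
      (U * Matrix.diagonal (fun j => if ε' ≤ E j then (1 : ℂ) else 0) * Uᴴ) =
      U * (Matrix.diagonal (fun j => if E j < ε then Complex.exp ((1 / 24 : ℂ) * E j) else 0) * W *
        Matrix.diagonal (fun j => if ε' ≤ E j then Complex.exp (-((1 / 24 : ℂ) * E j)) else 0))
        * Uᴴ := by
    have : Matrix.diagonal (fun j => if E j < ε then Complex.exp ((1 / 24 : ℂ) * E j) else 0) * W *
        Matrix.diagonal (fun j => if ε' ≤ E j then Complex.exp (-((1 / 24 : ℂ) * E j)) else 0) =
        Matrix.diagonal (fun j => if E j < ε then (1 : ℂ) else 0) * X' *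
        Matrix.diagonal (fun j => if ε' ≤ E j then (1 : ℂ) else 0) := by
      ext a b
      simp only [Matrix.mul_diagonal, Matrix.diagonal_mul, hWdef, Matrix.of_apply]
      split_ifs
      · have : Complex.exp ((1 / 24 : ℂ) * E a) * Complex.exp ((1 / 24 : ℂ) * (E b - E a)) *
            Complex.exp (-((1 / 24 : ℂ) * E b)) = 1 := by
          rw [← Complex.exp_add, ← Complex.exp_add, ← Complex.exp_zero]
          congr 1
          ring
        linear_combination (X' a b) * this
      all_goals simp
    rw [this, hX']
    simp only [Matrix.mul_assoc]
  rw [e1, norm_conj_unitary U hU]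
  have hd1 : ‖(Matrix.diagonal (fun j => if E j < ε then Complex.exp ((1 / 24 : ℂ) * E j) else 0) :
      Matrix (Cfg n) (Cfg n) ℂ)‖ ≤ Real.exp (ε / 24) := by
    rw [Matrix.l2_opNorm_diagonal]
    refine (pi_norm_le_iff_of_nonneg (Real.exp_pos _).le).2 fun j => ?_
    split_ifs with hj
    · rw [Complex.norm_exp]
      apply Real.exp_le_exp.2
      have : ((1 / 24 : ℂ) * E j).re = E j / 24 := by
        simp; ring
      rw [this]
      linarith
    · simp [(Real.exp_pos _).le]
  have hd2 : ‖(Matrix.diagonal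
      (fun j => if ε' ≤ E j then Complex.exp (-((1 / 24 : ℂ) * E j)) else 0) :
      Matrix (Cfg n) (Cfg n) ℂ)‖ ≤ Real.exp (-(ε' / 24)) := by
    rw [Matrix.l2_opNorm_diagonal]
    refine (pi_norm_le_iff_of_nonneg (Real.exp_pos _).le).2 fun j => ?_
    split_ifs with hj
    · rw [Complex.norm_exp]
      apply Real.exp_le_exp.2
      have : (-((1 / 24 : ℂ) * E j)).re = -(E j / 24) := by
        simp; ring
      rw [this]
      linarith
    · simp [(Real.exp_pos _).le]
  calc _ ≤ Real.exp (ε / 24) * (2 * (2 ^ (2 * k) * ‖X‖)) * Real.exp (-(ε' / 24)) := by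
        refine (norm_mul_le _ _).trans ?_
        refine mul_le_mul ((norm_mul_le _ _).trans ?_) hd2 (norm_nonneg _) (by positivity)
        exact mul_le_mul hd1 hW (norm_nonneg _) (Real.exp_pos _).le
    _ = 2 * 2 ^ (2 * k) * ‖X‖ * (Real.exp (ε / 24) * Real.exp (-(ε' / 24))) := by ring
    _ = _ := by
      rw [← Real.exp_add]
      congr 2
      ring
end
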